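/- For every integer n ≥ 2, the double sum over ℓ from 1 to n-1 and k from n-ℓ to n-1 of [2·2^{n-ℓ-1}·(2^{n-ℓ}-2)·(2^{n-k-1}-1)·2^{n-k-1} + 2·(2^{k+ℓ-n}-1)·2^{n-ℓ-1}·2^{n-ℓ}·2^{n-k-1}·2^{n-k-1}] equals (1/2)·n·2^{2n} - (7/3)·2^{2n} + 2·n·2^n + 2^n + 4/3. -/

import Mathlib

theorem sum_range_overlap_terms (A X : ℚ) (i : ℕ) :
    ∑ j ∈ Finset.range i,
      (2 * A * (2 * A - 2) * (X / 2 ^ (j + 1) - 1) * (X / 2 ^ (j + 1))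
        + 2 * (2 ^ j - 1) * A * (2 * A) * (X / 2 ^ (j + 1)) * (X / 2 ^ (j + 1)))
    = 2 * A * (2 * A - 2) * (X ^ 2 * (1 - 1 / (2 ^ i) ^ 2) / 3 - X * (1 - 1 / 2 ^ i))
      + 4 * A ^ 2 * (X ^ 2 / 2 * (1 - 1 / 2 ^ i) - X ^ 2 * (1 - 1 / (2 ^ i) ^ 2) / 3) := by
  induction i with
  | zero => simp
  | succ i ih =>
    rw [Finset.sum_range_succ, ih]
    have h : (2 : ℚ) ^ i ≠ 0 := by positivity
    simp only [pow_succ (2 : ℚ) i]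
    generalize (2 : ℚ) ^ i = P at *
    field_simp
    ring

theorem sum_Icc_overlap_terms (M : ℚ) (j : ℕ) :
    ∑ c ∈ Finset.Icc 1 j,
      (2 * M ^ 2 + 4 * M - 4 / 3 * M * 2 ^ c - 6 * M * (M / 2 ^ c) + 4 * (M / 2 ^ c) ^ 2
        - 8 / 3 * (M / 2 ^ c))
    = j * (2 * M ^ 2 + 4 * M) - 4 / 3 * M * (2 * 2 ^ j - 2)
      - (6 * M + 8 / 3) * (M * (1 - 1 / 2 ^ j)) + 4 * (M ^ 2 * (1 - 1 / (2 ^ j) ^ 2) / 3) := by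
  induction j with
  | zero => simp
  | succ j ih =>
    rw [Finset.sum_Icc_succ_top (by omega), ih]
    have h : (2 : ℚ) ^ j ≠ 0 := by positivity
    simp only [pow_succ (2 : ℚ) j]
    push_cast
    generalize (2 : ℚ) ^ j = P at *
    field_simp
    ring

theorem stmt_2 (n : ℕ) (hn : 2 ≤ n) :
    (∑ ℓ ∈ Finset.Icc 1 (n-1), ∑ k ∈ Finset.Icc (n-ℓ) (n-1),
      ((2 * 2^(n-ℓ-1) * (2^(n-ℓ)-2) * (2^(n-k-1)-1) * 2^(n-k-1)
        + 2 * (2^(k+ℓ-n)-1) * 2^(n-ℓ-1) * 2^(n-ℓ) * 2^(n-k-1) * 2^(n-k-1)) : ℚ))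
    = (1/2) * n * 2^(2*n) - (7/3) * 2^(2*n) + 2 * n * 2^n + 2^n + 4/3 := by
  obtain ⟨m, rfl⟩ : ∃ m, n = m + 1 := ⟨n - 1, by omega⟩
  rw [Nat.add_sub_cancel]
  trans ∑ c ∈ Finset.Icc 1 m,
      (2 * ((2 : ℚ) ^ m) ^ 2 + 4 * 2 ^ m - 4 / 3 * 2 ^ m * 2 ^ c - 6 * 2 ^ m * (2 ^ m / 2 ^ c)
        + 4 * (2 ^ m / 2 ^ c) ^ 2 - 8 / 3 * (2 ^ m / 2 ^ c))
  · refine Finset.sum_congr rfl fun c hc ↦ ?_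
    obtain ⟨-, hcm⟩ := Finset.mem_Icc.mp hc
    obtain ⟨d, rfl⟩ := Nat.exists_eq_add_of_le hcm
    have hIcc : Finset.Icc (c + d + 1 - c) (c + d) = Finset.Ico (d + 1) (d + 1 + c) := by
      ext k
      simp only [Finset.mem_Icc, Finset.mem_Ico]
      omega
    rw [hIcc, Finset.sum_Ico_eq_sum_range, Nat.add_sub_cancel_left]
    trans ∑ j ∈ Finset.range c,
      (2 * (2 : ℚ) ^ d * (2 * 2 ^ d - 2) * (2 ^ c / 2 ^ (j + 1) - 1) * (2 ^ c / 2 ^ (j + 1))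
        + 2 * (2 ^ j - 1) * 2 ^ d * (2 * 2 ^ d) * (2 ^ c / 2 ^ (j + 1)) * (2 ^ c / 2 ^ (j + 1)))
    · refine Finset.sum_congr rfl fun j hj ↦ ?_
      have hjc : j + 1 ≤ c := Finset.mem_range.mp hj
      have hB : (2 : ℚ) ^ c / 2 ^ (j + 1) = 2 ^ (c - (j + 1)) :=
        (pow_sub₀ (2 : ℚ) two_ne_zero hjc).symm
      rw [hB, show c + d + 1 - c - 1 = d by omega, show c + d + 1 - c = d + 1 by omega,
        show c + d + 1 - (d + 1 + j) - 1 = c - (j + 1) by omega,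
        show d + 1 + j + c - (c + d + 1) = j by omega, pow_succ' (2 : ℚ) d]
    · rw [sum_range_overlap_terms, pow_add]
      have hC : (2 : ℚ) ^ c ≠ 0 := by positivity
      field_simp
      ring
  · rw [sum_Icc_overlap_terms, show 2 * (m + 1) = m + m + 2 by ring]
    simp only [pow_add]
    have hM : (2 : ℚ) ^ m ≠ 0 := by positivity
    push_cast
    field_simp
    ring
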